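/- Let f : ℝ^d → [0,∞) be a proper log-concave function. If there exists a Gaussian density that is pointwise ≤ f, then there exists a Gaussian density pointwise ≤ f whose integral is maximal among all Gaussian densities pointwise ≤ f. Moreover, any two Gaussian densities of maximal integral among those pointwise ≤ f are translates of each other: if G[(A_1⊕α_1, a_1)] and G[(A_2⊕α_2, a_2)] are both pointwise ≤ f and both of maximal integral, then A_1 = A_2 and α_1 = α_2. -/

import Mathlib

open MeasureTheory
open scoped BigOperators RealInnerProductSpace

noncomputable section

/-- `ℝ^d` with the Euclidean structure. -/
abbrev Ed (d : ℕ) := EuclideanSpace ℝ (Fin d)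

/-- `f : ℝ^d → [0,∞)` is log-concave, i.e. `f = e^{-ψ}` for some convex
`ψ : ℝ^d → ℝ ∪ {∞}`; equivalently, `f ≥ 0` and
`f(tx+(1-t)y) ≥ f(x)^t f(y)^{1-t}`. -/
def IsLogConcave {d : ℕ} (f : Ed d → ℝ) : Prop :=
  (∀ x, 0 ≤ f x) ∧
    ∀ x y : Ed d, ∀ t : ℝ, 0 ≤ t → t ≤ 1 →
      f x ^ t * f y ^ (1 - t) ≤ f (t • x + (1 - t) • y)

/-- A proper log-concave function: log-concave, upper semicontinuous,
with positive finite integral. -/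
def ProperLogConcave {d : ℕ} (f : Ed d → ℝ) : Prop :=
  IsLogConcave f ∧ UpperSemicontinuous f ∧
    0 < ∫⁻ x, ENNReal.ofReal (f x) ∧ (∫⁻ x, ENNReal.ofReal (f x)) < ⊤

/-- The `s`-lifting of `f`, a subset of `ℝ^d × ℝ = ℝ^{d+1}`. -/
def sLift {d : ℕ} (s : ℝ) (f : Ed d → ℝ) : Set (Ed d × ℝ) :=
  {p | |p.2| ≤ f p.1 ^ (1 / s)}

/-- The `d`-symmetric ellipsoid `(A⊕α)B^{d+1} + a` in `ℝ^{d+1} = ℝ^d × ℝ`. -/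
def ellE {d : ℕ} (A : Matrix (Fin d) (Fin d) ℝ) (α : ℝ) (a : Ed d) : Set (Ed d × ℝ) :=
  {p | ∃ y : Ed d, ∃ t : ℝ, ‖y‖ ^ 2 + t ^ 2 ≤ 1 ∧
        p.1 = Matrix.toEuclideanLin A y + a ∧ p.2 = α * t}

/-- The closed Euclidean unit ball `B^{d+1}` of `ℝ^{d+1} = ℝ^d × ℝ`. -/
def unitBallE (d : ℕ) : Set (Ed d × ℝ) := {p | ‖p.1‖ ^ 2 + p.2 ^ 2 ≤ 1}

/-- `κ_s = ∫_{B^d} (1-|x|²)^{s/2} dx`. -/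
def kappa (d : ℕ) (s : ℝ) : ℝ :=
  ∫ x in Metric.closedBall (0 : Ed d) 1, (1 - ‖x‖ ^ 2) ^ (s / 2)

/-- The `s`-volume of the ellipsoid represented by `(A⊕α, a)`:
`μ_s = κ_s α^s det A`. -/
def svol {d : ℕ} (s : ℝ) (A : Matrix (Fin d) (Fin d) ℝ) (α : ℝ) : ℝ :=
  kappa d s * α ^ s * A.det

/-- `(A, α, a)` represents the John `s`-ellipsoid of `f`: it is a d-symmetric
ellipsoid contained in the `s`-lifting of `f` of maximal `s`-volume. -/
def IsJohn {d : ℕ} (s : ℝ) (f : Ed d → ℝ)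
    (A : Matrix (Fin d) (Fin d) ℝ) (α : ℝ) (a : Ed d) : Prop :=
  A.PosDef ∧ 0 < α ∧ ellE A α a ⊆ sLift s f ∧
    ∀ (A' : Matrix (Fin d) (Fin d) ℝ) (α' : ℝ) (a' : Ed d),
      A'.PosDef → 0 < α' → ellE A' α' a' ⊆ sLift s f → svol s A' α' ≤ svol s A α

/-- The height function of the ellipsoid represented by `(A⊕α, a)`. -/
def heightFn {d : ℕ} (A : Matrix (Fin d) (Fin d) ℝ) (α : ℝ) (a : Ed d) (x : Ed d) : ℝ :=
  if ‖Matrix.toEuclideanLin A⁻¹ (x - a)‖ ≤ 1 then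
    α * Real.sqrt (1 - ‖Matrix.toEuclideanLin A⁻¹ (x - a)‖ ^ 2)
  else 0

/-- A point of `ℝ^d × ℝ` as a vector in `ℝ^{d+1}`. -/
def augVec {d : ℕ} (p : Ed d × ℝ) : Fin (d + 1) → ℝ :=
  Fin.snoc (fun i => p.1 i) p.2

/-- The block-diagonal matrix `A ⊕ α`. -/
def matAug {d : ℕ} (A : Matrix (Fin d) (Fin d) ℝ) (α : ℝ) :
    Matrix (Fin (d + 1)) (Fin (d + 1)) ℝ :=
  Matrix.of fun i j =>
    Fin.lastCases (Fin.lastCases α (fun _ => 0) j)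
      (fun i' => Fin.lastCases 0 (fun j' => A i' j') j) i

/-- The Frobenius norm of a real matrix. -/
def frobNorm {n : ℕ} (M : Matrix (Fin n) (Fin n) ℝ) : ℝ :=
  Real.sqrt (∑ i, ∑ j, M i j ^ 2)

/-- Asplund sum (sup-convolution) of two functions. -/
def asplund {d : ℕ} (f g : Ed d → ℝ) : Ed d → ℝ :=
  fun x => ⨆ y : Ed d, f y * g (x - y)

/-- Epi-product `(λ ∗ f)(x) = f(x/λ)^λ`. -/
def epiProd {d : ℕ} (l : ℝ) (f : Ed d → ℝ) : Ed d → ℝ :=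
  fun x => f (l⁻¹ • x) ^ l

/-- The flat ellipsoid function `α · χ_{A B^d + a}`. -/
def flatFn {d : ℕ} (A : Matrix (Fin d) (Fin d) ℝ) (α : ℝ) (a : Ed d) (x : Ed d) : ℝ :=
  if ‖Matrix.toEuclideanLin A⁻¹ (x - a)‖ ≤ 1 then α else 0

/-- The Gaussian density `G[(A⊕α, a)](x) = α e^{−|A^{-1}(x−a)|²}`. -/
def gaussFn {d : ℕ} (A : Matrix (Fin d) (Fin d) ℝ) (α : ℝ) (a : Ed d) (x : Ed d) : ℝ :=
  α * Real.exp (-‖Matrix.toEuclideanLin A⁻¹ (x - a)‖ ^ 2)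

/-- Operator (`ℓ₂ → ℓ₂`) norm of a matrix. -/
def opNorm {d : ℕ} (M : Matrix (Fin d) (Fin d) ℝ) : ℝ :=
  ‖Matrix.toEuclideanCLM (𝕜 := ℝ) M‖

theorem Matrix.IsHermitian.det_add_smul_one {n : Type*} [Fintype n] [DecidableEq n]
    {A : Matrix n n ℝ} (hA : A.IsHermitian) (s : ℝ) :
    (A + s • (1 : Matrix n n ℝ)).det = ∏ i, (hA.eigenvalues i + s) := by
  have h := A.eval_charpoly (-s)
  rw [hA.charpoly_eq, Polynomial.eval_prod] at h
  have h2 : Matrix.scalar n (-s) - A = -(A + s • (1 : Matrix n n ℝ)) := by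
    simp [← Matrix.smul_one_eq_diagonal, sub_eq_add_neg, add_comm]
  rw [h2, Matrix.det_neg] at h
  have h3 : ∏ i, (hA.eigenvalues i + s) =
      (-1 : ℝ) ^ Fintype.card n * ∏ i, (-s - hA.eigenvalues i) := by
    rw [← Finset.card_univ, ← Finset.prod_const, ← Finset.prod_mul_distrib]
    exact Finset.prod_congr rfl fun i _ => by ring
  simp only [Polynomial.eval_sub, Polynomial.eval_X, Polynomial.eval_C, RCLike.ofReal_real_eq_id,
    id] at h
  rw [h3, h, ← mul_assoc, ← mul_pow]
  simp

theorem Matrix.IsHermitian.det_half_add_smul_one {n : Type*} [Fintype n] [DecidableEq n]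
    {A : Matrix n n ℝ} (hA : A.IsHermitian) (s : ℝ) :
    ((2⁻¹ : ℝ) • (A + s • (1 : Matrix n n ℝ))).det = ∏ i, ((hA.eigenvalues i + s) / 2) := by
  rw [Matrix.det_smul, hA.det_add_smul_one, ← Finset.card_univ, ← Finset.prod_const,
    ← Finset.prod_mul_distrib]
  exact Finset.prod_congr rfl fun i _ => by ring

theorem Matrix.PosDef.eq_one_of_sq_det_half_add_one_le {n : Type*} [Fintype n] [DecidableEq n]
    {M : Matrix n n ℝ} (hM : M.PosDef) (h : ((2⁻¹ : ℝ) • (M + 1)).det ^ 2 ≤ M.det) : M = 1 := by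
  have h1 := hM.1.det_half_add_smul_one 1
  rw [one_smul] at h1
  rw [h1, hM.1.det_eq_prod_eigenvalues, ← Finset.prod_pow] at h
  simp only [RCLike.ofReal_real_eq_id, id] at h
  have hev : ∀ i, hM.1.eigenvalues i = 1 := by
    by_contra! hne
    obtain ⟨j, hj⟩ := hne
    refine absurd h (not_le.2 (Finset.prod_lt_prod (fun i _ => hM.eigenvalues_pos i)
      (fun i _ => ?_) ⟨j, Finset.mem_univ _, ?_⟩))
    · nlinarith [sq_nonneg (hM.1.eigenvalues i - 1)]
    · nlinarith [sq_pos_of_ne_zero (sub_ne_zero.2 hj)]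
  have hs := hM.1.spectral_theorem
  have hd : Matrix.diagonal (RCLike.ofReal ∘ hM.1.eigenvalues) = (1 : Matrix n n ℝ) := by
    rw [← Matrix.diagonal_one]
    congr 1
    ext i
    simp [hev i]
  rw [hs, hd, map_one]

/-- The equality case of midpoint log-concavity of the determinant. -/
theorem Matrix.PosDef.eq_of_sq_det_half_add_le {n : Type*} [Fintype n] [DecidableEq n]
    {A B : Matrix n n ℝ} (hA : A.PosDef) (hB : B.PosDef)
    (h : ((2⁻¹ : ℝ) • (A + B)).det ^ 2 ≤ A.det * B.det) : A = B := by
  open scoped MatrixOrder in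
  obtain ⟨C, hC, rfl⟩ : ∃ C : Matrix n n ℝ, IsUnit C ∧ A = star C * C := by
    obtain ⟨C, hC⟩ := CStarAlgebra.nonneg_iff_eq_star_mul_self.mp hA.posSemidef.nonneg
    refine ⟨C, ?_, hC⟩
    have := hA.det_pos
    rw [Matrix.isUnit_iff_isUnit_det, isUnit_iff_ne_zero]
    intro h0
    rw [hC, Matrix.det_mul, h0] at this
    simp at this
  obtain ⟨U, rfl⟩ := hC
  obtain ⟨M, rfl⟩ : ∃ M : Matrix n n ℝ, B = star (U : Matrix n n ℝ) * M * U := by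
    refine ⟨star ((U⁻¹ : (Matrix n n ℝ)ˣ) : Matrix n n ℝ) * B *
      ((U⁻¹ : (Matrix n n ℝ)ˣ) : Matrix n n ℝ), ?_⟩
    rw [← mul_assoc, ← mul_assoc, ← star_mul, mul_assoc, Units.inv_mul]
    simp
  have hM : M.PosDef := (Matrix.IsUnit.posDef_star_left_conjugate_iff U.isUnit).1 hB
  have hsum : (2⁻¹ : ℝ) • (star (U : Matrix n n ℝ) * U + star (U : Matrix n n ℝ) * M * U) =
      star (U : Matrix n n ℝ) * ((2⁻¹ : ℝ) • (M + 1)) * U := by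
    simp only [mul_smul_comm, smul_mul_assoc, mul_add, add_mul, mul_one]
    rw [add_comm]
  have hU := hA.det_pos
  rw [hsum] at h
  simp only [Matrix.det_mul] at h hU
  have hM1 := hM.eq_one_of_sq_det_half_add_one_le (by
    refine le_of_mul_le_mul_left ?_ (pow_pos hU 2)
    linarith)
  rw [hM1, mul_one]

theorem Matrix.PosDef.eigenvalues_le_of_sq_det_le {n : Type*} [Fintype n] [DecidableEq n]
    {A : Matrix n n ℝ} (hA : A.PosDef) {ε C : ℝ} (hε : 0 < ε)
    (h : ((2⁻¹ : ℝ) • (A + ε • (1 : Matrix n n ℝ))).det ^ 2 ≤ C * A.det) (j : n) :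
    hA.1.eigenvalues j ≤ 4 * C / ε ^ (Fintype.card n - 1) := by
  have hp := hA.eigenvalues_pos
  rw [hA.1.det_half_add_smul_one, hA.1.det_eq_prod_eigenvalues, ← Finset.prod_pow,
    ← Finset.mul_prod_erase _ _ (Finset.mem_univ j),
    ← Finset.mul_prod_erase _ _ (Finset.mem_univ j)] at h
  simp only [RCLike.ofReal_real_eq_id, id] at h
  have h1 : ε ^ (Fintype.card n - 1) * ∏ i ∈ Finset.univ.erase j, hA.1.eigenvalues i ≤
      ∏ i ∈ Finset.univ.erase j, ((hA.1.eigenvalues i + ε) / 2) ^ 2 := by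
    rw [← Finset.card_univ, ← Finset.card_erase_of_mem (Finset.mem_univ j), ← Finset.prod_const,
      ← Finset.prod_mul_distrib]
    refine Finset.prod_le_prod (fun i _ => (mul_pos hε (hp i)).le) fun i _ => ?_
    nlinarith [sq_nonneg (hA.1.eigenvalues i - ε)]
  have hP : 0 < ∏ i ∈ Finset.univ.erase j, hA.1.eigenvalues i :=
    Finset.prod_pos fun i _ => hp i
  set P := ∏ i ∈ Finset.univ.erase j, hA.1.eigenvalues i
  set l := hA.1.eigenvalues j
  have hl0 : 0 < l := hp j
  have h2 : (l / 2) ^ 2 * (ε ^ (Fintype.card n - 1) * P) ≤ C * (l * P) :=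
    le_trans (by gcongr; linarith) h
  rw [le_div_iff₀ (by positivity)]
  refine le_of_mul_le_mul_right ?_ (mul_pos hl0 hP)
  linarith

theorem Matrix.PosDef.abs_apply_le_trace {n : Type*} [Fintype n] [DecidableEq n]
    {A : Matrix n n ℝ} (hA : A.PosDef) (i j : n) : |A i j| ≤ A.trace := by
  have hdiag : ∀ k, 0 ≤ A k k := fun k => hA.posSemidef.diag_nonneg
  have hle : ∀ k, A k k ≤ A.trace := fun k =>
    Finset.single_le_sum (f := fun k => A k k) (fun k _ => hdiag k) (Finset.mem_univ k)
  have hs : A j i = A i j := by simpa using hA.1.apply i j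
  have key : ∀ s : ℝ, 0 ≤ A i i + s * A i j + s * (A j i + s * A j j) := fun s => by
    have := hA.posSemidef.dotProduct_mulVec_nonneg (Pi.single i 1 + s • Pi.single j 1)
    simpa [Matrix.mulVec_add, Matrix.mulVec_smul, add_dotProduct, dotProduct_add, mul_add,
      add_assoc, add_comm, add_left_comm, mul_comm, mul_left_comm] using this
  rw [abs_le]
  constructor
  · linarith [key 1, hle i, hle j]
  · linarith [key (-1), hle i, hle j]

/-- The Gaussian represented by `(A ⊕ α, a)` lies below `f`, written in the coordinate
`u = A⁻¹ (x - a)`; this form does not need `A` to be invertible. -/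
def GaussBelow {d : ℕ} (f : Ed d → ℝ) (A : Matrix (Fin d) (Fin d) ℝ) (α : ℝ) (a : Ed d) : Prop :=
  ∀ u : Ed d, α * Real.exp (-‖u‖ ^ 2) ≤ f (Matrix.toEuclideanLin A u + a)

theorem toEuclideanLin_inv_apply {d : ℕ} {A : Matrix (Fin d) (Fin d) ℝ} (hA : A.PosDef)
    (u : Ed d) : Matrix.toEuclideanLin A⁻¹ (Matrix.toEuclideanLin A u) = u := by
  have hdet : IsUnit A.det := isUnit_iff_ne_zero.2 hA.det_pos.ne'
  simp [Matrix.toLpLin_apply, Matrix.mulVec_mulVec, Matrix.nonsing_inv_mul _ hdet]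

theorem toEuclideanLin_apply_inv {d : ℕ} {A : Matrix (Fin d) (Fin d) ℝ} (hA : A.PosDef)
    (u : Ed d) : Matrix.toEuclideanLin A (Matrix.toEuclideanLin A⁻¹ u) = u := by
  have hdet : IsUnit A.det := isUnit_iff_ne_zero.2 hA.det_pos.ne'
  simp [Matrix.toLpLin_apply, Matrix.mulVec_mulVec, Matrix.mul_nonsing_inv _ hdet]

theorem gaussBelow_iff {d : ℕ} {f : Ed d → ℝ} {A : Matrix (Fin d) (Fin d) ℝ} (hA : A.PosDef)
    {α : ℝ} {a : Ed d} : GaussBelow f A α a ↔ ∀ x, gaussFn A α a x ≤ f x := by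
  constructor
  · intro h x
    have := h (Matrix.toEuclideanLin A⁻¹ (x - a))
    rwa [toEuclideanLin_apply_inv hA, sub_add_cancel] at this
  · intro h u
    have := h (Matrix.toEuclideanLin A u + a)
    rwa [gaussFn, add_sub_cancel_right, toEuclideanLin_inv_apply hA] at this

theorem GaussBelow.midpoint {d : ℕ} {f : Ed d → ℝ} (hf : IsLogConcave f)
    {A B : Matrix (Fin d) (Fin d) ℝ} {α β : ℝ} {a b : Ed d} (hα : 0 < α) (hβ : 0 < β)
    (hA : GaussBelow f A α a) (hB : GaussBelow f B β b) :
    GaussBelow f ((2⁻¹ : ℝ) • (A + B)) (√(α * β)) ((2⁻¹ : ℝ) • (a + b)) := by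
  intro u
  have h := hf.2 (Matrix.toEuclideanLin A u + a) (Matrix.toEuclideanLin B u + b) (1 / 2)
    (by norm_num) (by norm_num)
  rw [show (1 - 1 / 2 : ℝ) = 1 / 2 by norm_num, ← Real.sqrt_eq_rpow, ← Real.sqrt_eq_rpow,
    ← Real.sqrt_mul (hf.1 _)] at h
  have harg : Matrix.toEuclideanLin ((2⁻¹ : ℝ) • (A + B)) u + (2⁻¹ : ℝ) • (a + b) =
      (1 / 2 : ℝ) • (Matrix.toEuclideanLin A u + a) +
        (1 / 2 : ℝ) • (Matrix.toEuclideanLin B u + b) := by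
    rw [map_smul, map_add]
    simp only [LinearMap.smul_apply, LinearMap.add_apply, one_div]
    module
  rw [harg]
  refine le_trans ?_ h
  have he := Real.exp_pos (-‖u‖ ^ 2)
  have hmul : √(α * β) * Real.exp (-‖u‖ ^ 2) =
      √((α * Real.exp (-‖u‖ ^ 2)) * (β * Real.exp (-‖u‖ ^ 2))) := by
    rw [show (α * Real.exp (-‖u‖ ^ 2)) * (β * Real.exp (-‖u‖ ^ 2)) =
      (α * β) * Real.exp (-‖u‖ ^ 2) ^ 2 by ring, Real.sqrt_mul (mul_pos hα hβ).le,
      Real.sqrt_sq he.le]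
  rw [hmul]
  exact Real.sqrt_le_sqrt (mul_le_mul (hA u) (hB u) (by positivity) (hf.1 _))

theorem det_toEuclideanLin {d : ℕ} (A : Matrix (Fin d) (Fin d) ℝ) :
    LinearMap.det (Matrix.toEuclideanLin A) = A.det := by
  rw [Matrix.toEuclideanLin_eq_toLin_orthonormal, LinearMap.det_toLin]

theorem integral_gaussFn {d : ℕ} {A : Matrix (Fin d) (Fin d) ℝ} (hA : A.PosDef)
    (α : ℝ) (a : Ed d) :
    ∫ x, gaussFn A α a x = α * A.det * ∫ x : Ed d, Real.exp (-‖x‖ ^ 2) := by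
  have hdet : LinearMap.det (Matrix.toEuclideanLin A⁻¹) = A.det⁻¹ := by
    rw [det_toEuclideanLin, Matrix.det_nonsing_inv, Ring.inverse_eq_inv']
  have hpos := hA.det_pos
  have hmap := Measure.map_linearMap_addHaar_eq_smul_addHaar (volume : Measure (Ed d))
    (f := Matrix.toEuclideanLin A⁻¹) (by rw [hdet]; positivity)
  have hcont : Continuous (Matrix.toEuclideanLin A⁻¹) :=
    LinearMap.continuous_of_finiteDimensional _
  simp only [gaussFn]
  rw [integral_sub_right_eq_self
      (fun x => α * Real.exp (-‖Matrix.toEuclideanLin A⁻¹ x‖ ^ 2)) a,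
    integral_const_mul, mul_assoc]
  congr 1
  rw [← integral_map (μ := volume) (φ := Matrix.toEuclideanLin A⁻¹)
      (f := fun y : Ed d => Real.exp (-‖y‖ ^ 2)) hcont.aemeasurable
      (by fun_prop), hmap, integral_smul_measure, hdet, inv_inv, abs_of_pos hpos,
    ENNReal.toReal_ofReal hpos.le, smul_eq_mul]

theorem integral_exp_neg_norm_sq_pos (d : ℕ) : 0 < ∫ x : Ed d, Real.exp (-‖x‖ ^ 2) := by
  have := GaussianFourier.integral_rexp_neg_mul_sq_norm (V := Ed d) (b := 1) one_pos
  simp only [neg_mul, one_mul] at this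
  rw [this]
  positivity

theorem ProperLogConcave.integrable {d : ℕ} {f : Ed d → ℝ} (hf : ProperLogConcave f) :
    Integrable f :=
  (lintegral_ofReal_ne_top_iff_integrable hf.2.1.measurable.aestronglyMeasurable
    (Filter.Eventually.of_forall hf.1.1)).1 hf.2.2.2.ne

theorem GaussBelow.mul_det_mul_integral_le {d : ℕ} {f : Ed d → ℝ} (hf : ProperLogConcave f)
    {A : Matrix (Fin d) (Fin d) ℝ} (hA : A.PosDef) {α : ℝ} (hα : 0 < α) {a : Ed d}
    (h : GaussBelow f A α a) :
    α * A.det * ∫ x : Ed d, Real.exp (-‖x‖ ^ 2) ≤ ∫ x, f x := by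
  rw [← integral_gaussFn hA α a]
  refine integral_mono_of_nonneg (Filter.Eventually.of_forall fun x => ?_) hf.integrable
    (Filter.Eventually.of_forall ((gaussBelow_iff hA).1 h))
  simp only [gaussFn, Pi.zero_apply]
  positivity

theorem Matrix.PosDef.half_add {n : Type*} [Fintype n] {A B : Matrix n n ℝ} (hA : A.PosDef)
    (hB : B.PosDef) : ((2⁻¹ : ℝ) • (A + B)).PosDef :=
  (hA.add hB).smul (by norm_num)

theorem GaussBelow.eq_of_isMax {d : ℕ} {f : Ed d → ℝ} (hf : ProperLogConcave f)
    {A₁ A₂ : Matrix (Fin d) (Fin d) ℝ} {α₁ α₂ m : ℝ} {a₁ a₂ : Ed d}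
    (hA₁ : A₁.PosDef) (hα₁ : 0 < α₁) (h₁ : GaussBelow f A₁ α₁ a₁) (hm₁ : α₁ * A₁.det = m)
    (hA₂ : A₂.PosDef) (hα₂ : 0 < α₂) (h₂ : GaussBelow f A₂ α₂ a₂) (hm₂ : α₂ * A₂.det = m)
    (hmax : ∀ (A : Matrix (Fin d) (Fin d) ℝ) (α : ℝ) (a : Ed d), A.PosDef → 0 < α →
      GaussBelow f A α a → α * A.det ≤ m) : A₁ = A₂ ∧ α₁ = α₂ := by
  have hle := hmax _ _ _ (hA₁.half_add hA₂) (Real.sqrt_pos.2 (mul_pos hα₁ hα₂))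
    (h₁.midpoint hf.1 hα₁ hα₂ h₂)
  have hpos := (hA₁.half_add hA₂).det_pos
  set D := ((2⁻¹ : ℝ) • (A₁ + A₂)).det
  have hsq : (√(α₁ * α₂) * D) ^ 2 ≤ m ^ 2 := by gcongr
  rw [mul_pow, Real.sq_sqrt (by positivity)] at hsq
  have hA : A₁ = A₂ := by
    refine hA₁.eq_of_sq_det_half_add_le hA₂ (le_of_mul_le_mul_left ?_ (mul_pos hα₁ hα₂))
    calc α₁ * α₂ * D ^ 2 ≤ m * m := by rw [← sq]; exact hsq
      _ = (α₁ * A₁.det) * (α₂ * A₂.det) := by rw [hm₁, hm₂]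
      _ = α₁ * α₂ * (A₁.det * A₂.det) := by ring
  refine ⟨hA, ?_⟩
  subst hA
  exact mul_right_cancel₀ hA₁.det_pos.ne' (hm₁.trans hm₂.symm)

theorem GaussBelow.exists_smul_one {d : ℕ} {f : Ed d → ℝ} {A : Matrix (Fin d) (Fin d) ℝ}
    (hA : A.PosDef) {α : ℝ} (hα : 0 < α) {a : Ed d} (h : GaussBelow f A α a) :
    ∃ ε : ℝ, 0 < ε ∧ GaussBelow f (ε • (1 : Matrix (Fin d) (Fin d) ℝ)) α a := by
  set L := LinearMap.toContinuousLinearMap (Matrix.toEuclideanLin A⁻¹)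
  refine ⟨(‖L‖ + 1)⁻¹, by positivity, fun u => ?_⟩
  have hx := (gaussBelow_iff hA).1 h ((‖L‖ + 1)⁻¹ • u + a)
  have hone : Matrix.toEuclideanLin ((‖L‖ + 1)⁻¹ • (1 : Matrix (Fin d) (Fin d) ℝ)) u =
      (‖L‖ + 1)⁻¹ • u := by
    simp
  rw [hone]
  refine le_trans ?_ hx
  rw [gaussFn, add_sub_cancel_right]
  have hn : ‖Matrix.toEuclideanLin A⁻¹ ((‖L‖ + 1)⁻¹ • u)‖ ≤ ‖u‖ := by
    calc ‖L ((‖L‖ + 1)⁻¹ • u)‖ ≤ ‖L‖ * ‖(‖L‖ + 1)⁻¹ • u‖ := L.le_opNorm _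
      _ = (‖L‖ / (‖L‖ + 1)) * ‖u‖ := by
        rw [norm_smul, Real.norm_of_nonneg (by positivity)]; ring
      _ ≤ 1 * ‖u‖ := by
        gcongr
        rw [div_le_one (by positivity)]
        linarith
      _ = ‖u‖ := one_mul _
  gcongr

theorem Matrix.isCompact_setOf_abs_apply_le {m n : Type*} (T : ℝ) :
    IsCompact {A : Matrix m n ℝ | ∀ i j, |A i j| ≤ T} := by
  have h : IsCompact {A : m → n → ℝ | ∀ i, A i ∈ {r : n → ℝ | ∀ j, r j ∈ Set.Icc (-T) T}} :=
    isCompact_pi_infinite fun _ => isCompact_pi_infinite fun _ => isCompact_Icc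
  simp only [abs_le]
  exact h

theorem continuous_toEuclideanLin_uncurry (d : ℕ) :
    Continuous fun p : Matrix (Fin d) (Fin d) ℝ × Ed d => Matrix.toEuclideanLin p.1 p.2 := by
  have h : Continuous fun p : Matrix (Fin d) (Fin d) ℝ × Ed d => p.1.mulVec p.2.ofLp :=
    continuous_fst.matrix_mulVec ((PiLp.continuous_ofLp 2 _).comp continuous_snd)
  exact (PiLp.continuous_toLp 2 _).comp h

theorem Matrix.isClosed_setOf_posSemidef {n : Type*} [Fintype n] :
    IsClosed {A : Matrix n n ℝ | A.PosSemidef} := by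
  simp only [Matrix.posSemidef_iff_dotProduct_mulVec, Set.ofPred_and, Set.ofPred_forall]
  refine IsClosed.inter (isClosed_eq (by fun_prop) continuous_id) (isClosed_iInter fun x => ?_)
  exact isClosed_le continuous_const (by fun_prop)

theorem isClosed_setOf_gaussBelow {d : ℕ} {f : Ed d → ℝ} (hf : UpperSemicontinuous f) :
    IsClosed {p : Matrix (Fin d) (Fin d) ℝ × ℝ × Ed d | GaussBelow f p.1 p.2.1 p.2.2} := by
  simp only [GaussBelow, Set.ofPred_forall]
  refine isClosed_iInter fun u => ?_
  have hcont : Continuous fun p : Matrix (Fin d) (Fin d) ℝ × ℝ × Ed d =>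
      (Matrix.toEuclideanLin p.1 u + p.2.2, p.2.1 * Real.exp (-‖u‖ ^ 2)) := by
    have := (continuous_toEuclideanLin_uncurry d).comp
      (f := fun p : Matrix (Fin d) (Fin d) ℝ × ℝ × Ed d => (p.1, u)) (by fun_prop)
    exact (this.add (by fun_prop)).prodMk (by fun_prop)
  exact hf.IsClosed_hypograph.preimage hcont

theorem isCompact_setOf_gaussBelow {d : ℕ} {f : Ed d → ℝ} (hf : UpperSemicontinuous f)
    (T δ lo hi R : ℝ) :
    IsCompact {p : Matrix (Fin d) (Fin d) ℝ × ℝ × Ed d |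
      (p.1.PosSemidef ∧ (∀ i j, |p.1 i j| ≤ T) ∧ δ ≤ p.1.det) ∧
        p.2.1 ∈ Set.Icc lo hi ∧ ‖p.2.2‖ ≤ R ∧ GaussBelow f p.1 p.2.1 p.2.2} := by
  have hbox := (Matrix.isCompact_setOf_abs_apply_le (m := Fin d) (n := Fin d) T).prod
    ((isCompact_Icc (a := lo) (b := hi)).prod (isCompact_closedBall (0 : Ed d) R))
  have hdet : IsClosed {p : Matrix (Fin d) (Fin d) ℝ × ℝ × Ed d | δ ≤ p.1.det} :=
    isClosed_le continuous_const continuous_fst.matrix_det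
  have hpsd := (Matrix.isClosed_setOf_posSemidef (n := Fin d)).preimage
    (continuous_fst (Y := ℝ × Ed d))
  refine (((hbox.inter_right hpsd).inter_right hdet).inter_right
    (isClosed_setOf_gaussBelow hf)).of_isClosed_subset ?_ ?_
  · convert (((hbox.inter_right hpsd).inter_right hdet).inter_right
      (isClosed_setOf_gaussBelow hf)).isClosed using 1
    ext p
    simp only [Set.mem_ofPred_eq, Set.mem_inter_iff, Set.mem_prod, Set.mem_preimage,
      mem_closedBall_zero_iff]
    tauto
  · intro p
    simp only [Set.mem_ofPred_eq, Set.mem_inter_iff, Set.mem_prod, Set.mem_preimage,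
      mem_closedBall_zero_iff]
    tauto

theorem ProperLogConcave.exists_setLIntegral_compl_closedBall_lt {d : ℕ} {f : Ed d → ℝ}
    (hf : ProperLogConcave f) {η : ENNReal} (hη : 0 < η) :
    ∃ R : ℝ, ∫⁻ x in (Metric.closedBall 0 R)ᶜ, ENNReal.ofReal (f x) < η := by
  have : IsFiniteMeasure ((volume : Measure (Ed d)).withDensity fun x => ENNReal.ofReal (f x)) :=
    isFiniteMeasure_withDensity hf.2.2.2.ne
  have ht := tendsto_measure_compl_closedBall_of_isTightMeasureSet
    (isTightMeasureSet_singleton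
      (μ := (volume : Measure (Ed d)).withDensity fun x => ENNReal.ofReal (f x))) 0
  obtain ⟨R, hR⟩ := (ht.eventually_lt_const hη).exists
  refine ⟨R, ?_⟩
  simpa [withDensity_apply _ Metric.isClosed_closedBall.measurableSet.compl] using hR

theorem ProperLogConcave.exists_center_bound {d : ℕ} {f : Ed d → ℝ} (hf : ProperLogConcave f)
    (T : ℝ) {δ lo : ℝ} (hδ : 0 < δ) (hlo : 0 < lo) :
    ∃ R : ℝ, ∀ (A : Matrix (Fin d) (Fin d) ℝ) (α : ℝ) (a : Ed d), (∀ i j, |A i j| ≤ T) →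
      δ ≤ A.det → lo ≤ α → GaussBelow f A α a → ‖a‖ ≤ R := by
  obtain ⟨S, hS⟩ := ((Matrix.isCompact_setOf_abs_apply_le T).prod
    (isCompact_closedBall (0 : Ed d) 1)).exists_bound_of_continuousOn
    (continuous_toEuclideanLin_uncurry d).continuousOn
  set c := ENNReal.ofReal (lo * Real.exp (-1))
  set v := volume (Metric.closedBall (0 : Ed d) 1)
  have hv0 : 0 < v := Metric.measure_closedBall_pos _ _ one_pos
  have hc0 : 0 < c := ENNReal.ofReal_pos.2 (by positivity)
  obtain ⟨R, hR⟩ := hf.exists_setLIntegral_compl_closedBall_lt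
    (η := c * (ENNReal.ofReal δ * v))
    (ENNReal.mul_pos hc0.ne' (ENNReal.mul_pos (ENNReal.ofReal_pos.2 hδ).ne' hv0.ne').ne')
  refine ⟨R + S, fun A α a hA hdet hα h => ?_⟩
  by_contra! hlt
  refine absurd hR (not_lt.2 ?_)
  set E := (fun x => x + a) '' (Matrix.toEuclideanLin A '' Metric.closedBall (0 : Ed d) 1) with hE
  have hEvol : ENNReal.ofReal δ * v ≤ volume E := by
    rw [hE, Set.image_add_right, measure_preimage_add_right, Measure.addHaar_image_linearMap,
      det_toEuclideanLin]
    gcongr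
    exact hdet.trans (le_abs_self _)
  have hEsub : E ⊆ (Metric.closedBall 0 R)ᶜ := by
    rintro _ ⟨_, ⟨u, hu, rfl⟩, rfl⟩ hmem
    have h1 := hS (A, u) ⟨hA, hu⟩
    rw [mem_closedBall_zero_iff] at hmem
    have h2 := norm_sub_le (Matrix.toEuclideanLin A u + a) (Matrix.toEuclideanLin A u)
    rw [add_sub_cancel_left] at h2
    simp only at h1 hmem
    linarith
  have hEle : ∀ x ∈ E, c ≤ ENNReal.ofReal (f x) := by
    rintro _ ⟨_, ⟨u, hu, rfl⟩, rfl⟩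
    refine ENNReal.ofReal_le_ofReal (le_trans ?_ (h u))
    rw [mem_closedBall_zero_iff] at hu
    have : ‖u‖ ^ 2 ≤ 1 := pow_le_one₀ (norm_nonneg u) hu
    have hα0 : 0 ≤ α := hlo.le.trans hα
    gcongr
  have hEmeas : MeasurableSet E :=
    (((isCompact_closedBall (0 : Ed d) 1).image
      (LinearMap.continuous_of_finiteDimensional (Matrix.toEuclideanLin A))).image
      (continuous_add_const a)).measurableSet
  calc c * (ENNReal.ofReal δ * v) ≤ c * volume E := by gcongr
    _ = ∫⁻ _ in E, c := (setLIntegral_const E c).symm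
    _ ≤ ∫⁻ x in E, ENNReal.ofReal (f x) := setLIntegral_mono' hEmeas hEle
    _ ≤ ∫⁻ x in (Metric.closedBall 0 R)ᶜ, ENNReal.ofReal (f x) := lintegral_mono_set hEsub

theorem ProperLogConcave.exists_shape_bounds {d : ℕ} {f : Ed d → ℝ} (hf : ProperLogConcave f)
    {ε β c : ℝ} {b : Ed d} (hε : 0 < ε) (hβ : 0 < β)
    (hb : GaussBelow f (ε • (1 : Matrix (Fin d) (Fin d) ℝ)) β b) (hc : 0 < c) :
    ∃ T δ lo hi : ℝ, 0 < δ ∧ 0 < lo ∧ ∀ (A : Matrix (Fin d) (Fin d) ℝ) (α : ℝ) (a : Ed d),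
      A.PosDef → 0 < α → c ≤ α * A.det → GaussBelow f A α a →
        (∀ i j, |A i j| ≤ T) ∧ δ ≤ A.det ∧ α ∈ Set.Icc lo hi := by
  set J := ∫ x : Ed d, Real.exp (-‖x‖ ^ 2)
  have hJ0 : 0 < J := integral_exp_neg_norm_sq_pos d
  have hεpd : (ε • (1 : Matrix (Fin d) (Fin d) ℝ)).PosDef := Matrix.PosDef.one.smul hε
  set I := ∫ x, f x
  have hI0 : 0 < I := lt_of_lt_of_le (mul_pos (mul_pos hβ hεpd.det_pos) hJ0)
    (hb.mul_det_mul_integral_le hf hεpd hβ)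
  set C := I ^ 2 / (J ^ 2 * β * c) with hC
  have hC0 : 0 < C := by positivity
  set K := 4 * C / ε ^ (Fintype.card (Fin d) - 1)
  have hK0 : 0 < K := by positivity
  set hi := I ^ 2 / (J ^ 2 * β * ((ε / 2) ^ d) ^ 2) with hhi
  have hhi0 : 0 < hi := by positivity
  refine ⟨d * K, c / hi, c / K ^ d, hi, by positivity, by positivity,
    fun A α a hA hα hcA h => ?_⟩
  have hAdet := hA.det_pos
  have hDpos := (hA.half_add hεpd).det_pos
  have hmid := (h.midpoint hf.1 hα hβ hb).mul_det_mul_integral_le hf (hA.half_add hεpd)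
    (Real.sqrt_pos.2 (mul_pos hα hβ))
  set D := ((2⁻¹ : ℝ) • (A + ε • (1 : Matrix (Fin d) (Fin d) ℝ))).det with hD
  have hsq : α * β * D ^ 2 * J ^ 2 ≤ I ^ 2 := by
    have : (√(α * β) * D * J) ^ 2 ≤ I ^ 2 := by gcongr
    rwa [mul_pow, mul_pow, Real.sq_sqrt (by positivity)] at this
  have hDC : D ^ 2 ≤ C * A.det := by
    rw [hC, div_mul_eq_mul_div, le_div_iff₀ (by positivity)]
    calc D ^ 2 * (J ^ 2 * β * c) ≤ D ^ 2 * (J ^ 2 * β * (α * A.det)) := by gcongr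
      _ = (α * β * D ^ 2 * J ^ 2) * A.det := by ring
      _ ≤ I ^ 2 * A.det := by gcongr
  have hev : ∀ j, hA.1.eigenvalues j ≤ K := hA.eigenvalues_le_of_sq_det_le hε hDC
  have hdetK : A.det ≤ K ^ d := by
    rw [hA.1.det_eq_prod_eigenvalues]
    calc ∏ i, (hA.1.eigenvalues i : ℝ) ≤ ∏ _i : Fin d, K :=
          Finset.prod_le_prod (fun i _ => (hA.eigenvalues_pos i).le) fun i _ => hev i
      _ = K ^ d := by simp
  have hDε : (ε / 2) ^ d ≤ D := by
    rw [hD, hA.1.det_half_add_smul_one]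
    calc (ε / 2) ^ d = ∏ _i : Fin d, ε / 2 := by
          simp only [Finset.prod_const, Finset.card_univ, Fintype.card_fin]
      _ ≤ _ := Finset.prod_le_prod (fun _ _ => by positivity) fun i _ => by
        linarith [hA.eigenvalues_pos i]
  have hαhi : α ≤ hi := by
    rw [hhi, le_div_iff₀ (by positivity)]
    calc α * (J ^ 2 * β * ((ε / 2) ^ d) ^ 2) ≤ α * (J ^ 2 * β * D ^ 2) := by gcongr
      _ = α * β * D ^ 2 * J ^ 2 := by ring
      _ ≤ I ^ 2 := hsq
  refine ⟨fun i j => (hA.abs_apply_le_trace i j).trans ?_, ?_, ?_, hαhi⟩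
  · rw [hA.1.trace_eq_sum_eigenvalues]
    simpa using Finset.sum_le_card_nsmul Finset.univ hA.1.eigenvalues K (fun j _ => hev j)
  · rw [div_le_iff₀ hhi0]
    calc c ≤ α * A.det := hcA
      _ ≤ hi * A.det := by gcongr
      _ = A.det * hi := mul_comm _ _
  · rw [div_le_iff₀ (by positivity)]
    exact hcA.trans (by gcongr)

theorem ProperLogConcave.exists_isMax_gaussBelow {d : ℕ} {f : Ed d → ℝ}
    (hf : ProperLogConcave f) {A₀ : Matrix (Fin d) (Fin d) ℝ} {α₀ : ℝ} {a₀ : Ed d}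
    (hA₀ : A₀.PosDef) (hα₀ : 0 < α₀) (h₀ : GaussBelow f A₀ α₀ a₀) :
    ∃ (A : Matrix (Fin d) (Fin d) ℝ) (α : ℝ) (a : Ed d), A.PosDef ∧ 0 < α ∧
      GaussBelow f A α a ∧ ∀ (A' : Matrix (Fin d) (Fin d) ℝ) (α' : ℝ) (a' : Ed d),
        A'.PosDef → 0 < α' → GaussBelow f A' α' a' → α' * A'.det ≤ α * A.det := by
  obtain ⟨ε, hε, hb⟩ := h₀.exists_smul_one hA₀ hα₀
  have hc : 0 < α₀ * A₀.det := mul_pos hα₀ hA₀.det_pos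
  obtain ⟨T, δ, lo, hi, hδ, hlo, hshape⟩ := hf.exists_shape_bounds hε hα₀ hb hc
  obtain ⟨R, hR⟩ := hf.exists_center_bound T hδ hlo
  have hmem : ∀ (A : Matrix (Fin d) (Fin d) ℝ) (α : ℝ) (a : Ed d), A.PosDef → 0 < α →
      α₀ * A₀.det ≤ α * A.det → GaussBelow f A α a →
      (A, α, a) ∈ {p : Matrix (Fin d) (Fin d) ℝ × ℝ × Ed d |
        (p.1.PosSemidef ∧ (∀ i j, |p.1 i j| ≤ T) ∧ δ ≤ p.1.det) ∧
        p.2.1 ∈ Set.Icc lo hi ∧ ‖p.2.2‖ ≤ R ∧ GaussBelow f p.1 p.2.1 p.2.2} := by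
    intro A α a hA hα hle h
    obtain ⟨h1, h2, h3⟩ := hshape A α a hA hα hle h
    exact ⟨⟨hA.posSemidef, h1, h2⟩, h3, hR A α a h1 h2 h3.1 h, h⟩
  obtain ⟨⟨A, α, a⟩, ⟨⟨hA, -, hdet⟩, hα, -, h⟩, hmax⟩ :=
    (isCompact_setOf_gaussBelow hf.2.1 T δ lo hi R).exists_isMaxOn
      ⟨_, hmem A₀ α₀ a₀ hA₀ hα₀ le_rfl h₀⟩
      (f := fun p => p.2.1 * p.1.det)
      ((continuous_fst.comp continuous_snd).mul continuous_fst.matrix_det).continuousOn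
  refine ⟨A, α, a, hA.posDef_iff_det_ne_zero.2 (hδ.trans_le hdet).ne', hlo.trans_le hα.1, h,
    fun A' α' a' hA' hα' h' => ?_⟩
  rcases le_total (α₀ * A₀.det) (α' * A'.det) with hle | hle
  · exact hmax (hmem A' α' a' hA' hα' hle h')
  · exact hle.trans (hmax (hmem A₀ α₀ a₀ hA₀ hα₀ le_rfl h₀))

/-- **Existence of a maximal Gaussian, uniqueness up to translation**
(Theorem 7.1). -/
theorem maximal_gaussian_below (d : ℕ) (hd : 1 ≤ d)
    (f : Ed d → ℝ) (hf : ProperLogConcave f)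
    (hex : ∃ (A : Matrix (Fin d) (Fin d) ℝ) (α : ℝ) (a : Ed d),
      A.PosDef ∧ 0 < α ∧ ∀ x, gaussFn A α a x ≤ f x) :
    (∃ (A : Matrix (Fin d) (Fin d) ℝ) (α : ℝ) (a : Ed d),
      A.PosDef ∧ 0 < α ∧ (∀ x, gaussFn A α a x ≤ f x) ∧
        ∀ (A' : Matrix (Fin d) (Fin d) ℝ) (α' : ℝ) (a' : Ed d),
          A'.PosDef → 0 < α' → (∀ x, gaussFn A' α' a' x ≤ f x) →
            (∫ x, gaussFn A' α' a' x) ≤ ∫ x, gaussFn A α a x) ∧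
    (∀ (A₁ A₂ : Matrix (Fin d) (Fin d) ℝ) (α₁ α₂ : ℝ) (a₁ a₂ : Ed d),
      A₁.PosDef → 0 < α₁ → (∀ x, gaussFn A₁ α₁ a₁ x ≤ f x) →
      A₂.PosDef → 0 < α₂ → (∀ x, gaussFn A₂ α₂ a₂ x ≤ f x) →
      (∀ (A' : Matrix (Fin d) (Fin d) ℝ) (α' : ℝ) (a' : Ed d),
        A'.PosDef → 0 < α' → (∀ x, gaussFn A' α' a' x ≤ f x) →
          (∫ x, gaussFn A' α' a' x) ≤ ∫ x, gaussFn A₁ α₁ a₁ x) →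
      (∀ (A' : Matrix (Fin d) (Fin d) ℝ) (α' : ℝ) (a' : Ed d),
        A'.PosDef → 0 < α' → (∀ x, gaussFn A' α' a' x ≤ f x) →
          (∫ x, gaussFn A' α' a' x) ≤ ∫ x, gaussFn A₂ α₂ a₂ x) →
      A₁ = A₂ ∧ α₁ = α₂) := by
  have hJ := integral_exp_neg_norm_sq_pos d
  obtain ⟨A₀, α₀, a₀, hA₀, hα₀, h₀⟩ := hex
  constructor
  · obtain ⟨A, α, a, hA, hα, h, hmax⟩ :=
      hf.exists_isMax_gaussBelow hA₀ hα₀ ((gaussBelow_iff hA₀).2 h₀)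
    refine ⟨A, α, a, hA, hα, (gaussBelow_iff hA).1 h, fun A' α' a' hA' hα' h' => ?_⟩
    rw [integral_gaussFn hA, integral_gaussFn hA']
    exact mul_le_mul_of_nonneg_right (hmax A' α' a' hA' hα' ((gaussBelow_iff hA').2 h')) hJ.le
  · intro A₁ A₂ α₁ α₂ a₁ a₂ hA₁ hα₁ h₁ hA₂ hα₂ h₂ hmax₁ hmax₂
    have heq := le_antisymm (hmax₁ A₂ α₂ a₂ hA₂ hα₂ h₂) (hmax₂ A₁ α₁ a₁ hA₁ hα₁ h₁)
    rw [integral_gaussFn hA₁, integral_gaussFn hA₂] at heq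
    refine GaussBelow.eq_of_isMax hf hA₁ hα₁ ((gaussBelow_iff hA₁).2 h₁) rfl hA₂ hα₂
      ((gaussBelow_iff hA₂).2 h₂) (mul_right_cancel₀ hJ.ne' heq) fun A α a hA hα h => ?_
    have := hmax₁ A α a hA hα ((gaussBelow_iff hA).1 h)
    rw [integral_gaussFn hA₁, integral_gaussFn hA] at this
    exact le_of_mul_le_mul_right this hJ
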